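/- For σ ∈ (0,1), θ > -σ, and integers 1 ≤ k ≤ n and m ≥ 1, the expected number of new species under the Pitman–Yor process satisfies ∑_{j=0}^m j · (θ/σ + k)_j 𝒞(m,j;σ,-n+kσ) / (θ+n)_m = (k + θ/σ) · ( (θ+n+σ)_m / (θ+n)_m − 1 ), where 𝒞(m,j;σ,-n+kσ) = (1/j!) ∑_{r=0}^j (-1)^r C(j,r) (n - σ(r+k))_m. -/

import Mathlib

/-- Rising factorial `(x)_n = x (x+1) ⋯ (x+n-1)`, with `(x)_0 = 1`. -/
noncomputable def risingFactorial (x : ℝ) : ℕ → ℝ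
  | 0 => 1
  | n + 1 => risingFactorial x n * (x + n)

/-- Non-central generalized factorial coefficient
`𝒞(m,j;σ,-n+kσ) = (1/j!) ∑_{r=0}^j (-1)^r C(j,r) (n - σ(r+k))_m`. -/
noncomputable def ncGenFactCoeff (σ : ℝ) (n k m j : ℕ) : ℝ :=
  (1 / (j.factorial : ℝ)) *
    ∑ r ∈ Finset.range (j + 1),
      (-1 : ℝ) ^ r * (j.choose r : ℝ) * risingFactorial ((n : ℝ) - σ * ((r : ℝ) + k)) m

theorem nc_zero_zero (σ : ℝ) (n k : ℕ) : ncGenFactCoeff σ n k 0 0 = 1 := by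
  simp [ncGenFactCoeff, risingFactorial]

theorem nc_zero_succ (σ : ℝ) (n k j : ℕ) : ncGenFactCoeff σ n k 0 (j + 1) = 0 := by
  have h := Int.alternating_sum_range_choose_of_ne (n := j + 1) (by omega)
  have h2 : ∑ r ∈ Finset.range (j + 1 + 1), (-1 : ℝ) ^ r * ((j + 1).choose r : ℝ) = 0 := by
    exact_mod_cast h
  simp only [ncGenFactCoeff, risingFactorial, mul_one, h2, mul_zero]

theorem nc_succ_zero (σ : ℝ) (n k m : ℕ) :
    ncGenFactCoeff σ n k (m + 1) 0 = ((n : ℝ) - σ * k + m) * ncGenFactCoeff σ n k m 0 := by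
  simp [ncGenFactCoeff, risingFactorial]
  ring

theorem alt_aux (j : ℕ) (f : ℕ → ℝ) :
    ∑ r ∈ Finset.range (j + 1 + 1), (-1 : ℝ) ^ r * ((j + 1).choose r : ℝ) * (r * f r) =
      (j + 1) * (∑ r ∈ Finset.range (j + 1 + 1), (-1 : ℝ) ^ r * ((j + 1).choose r : ℝ) * f r
        - ∑ r ∈ Finset.range (j + 1), (-1 : ℝ) ^ r * (j.choose r : ℝ) * f r) := by
  have h : ∑ r ∈ Finset.range (j + 1), (-1 : ℝ) ^ r * (j.choose r : ℝ) * f r =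
      ∑ r ∈ Finset.range (j + 1 + 1), (-1 : ℝ) ^ r * (j.choose r : ℝ) * f r := by
    rw [Finset.sum_range_succ _ (j + 1)]
    simp
  rw [h, ← Finset.sum_sub_distrib, Finset.mul_sum]
  refine Finset.sum_congr rfl fun r hr => ?_
  have hr' : r ≤ j + 1 := by
    have := Finset.mem_range.1 hr
    omega
  have e : (j.choose r : ℝ) * (j + 1) = ((j + 1).choose r : ℝ) * ((j : ℝ) + 1 - r) := by
    have e0 := Nat.choose_mul_succ_eq j r
    have e1 : ((j.choose r * (j + 1) : ℕ) : ℝ) = (((j + 1).choose r * (j + 1 - r) : ℕ) : ℝ) := by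
      rw [e0]
    rw [Nat.cast_mul, Nat.cast_mul, Nat.cast_sub hr'] at e1
    push_cast at e1
    exact e1
  linear_combination (-1 : ℝ) ^ r * f r * e

theorem nc_succ_succ (σ : ℝ) (n k m j : ℕ) :
    ncGenFactCoeff σ n k (m + 1) (j + 1) =
      ((n : ℝ) - σ * k + m - σ * (j + 1)) * ncGenFactCoeff σ n k m (j + 1)
        + σ * ncGenFactCoeff σ n k m j := by
  have h := alt_aux j (fun r => risingFactorial ((n : ℝ) - σ * ((r : ℝ) + k)) m)
  have h2 : ∑ r ∈ Finset.range (j + 1 + 1), (-1 : ℝ) ^ r * ((j + 1).choose r : ℝ) *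
        risingFactorial ((n : ℝ) - σ * ((r : ℝ) + k)) (m + 1) =
      ((n : ℝ) - σ * k + m) * ∑ r ∈ Finset.range (j + 1 + 1),
        (-1 : ℝ) ^ r * ((j + 1).choose r : ℝ) * risingFactorial ((n : ℝ) - σ * ((r : ℝ) + k)) m
      - σ * ∑ r ∈ Finset.range (j + 1 + 1), (-1 : ℝ) ^ r * ((j + 1).choose r : ℝ) *
        (r * risingFactorial ((n : ℝ) - σ * ((r : ℝ) + k)) m) := by
    rw [Finset.mul_sum, Finset.mul_sum, ← Finset.sum_sub_distrib]
    refine Finset.sum_congr rfl fun r _ => ?_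
    simp only [risingFactorial]
    ring
  simp only [ncGenFactCoeff]
  rw [h2, h, Nat.factorial_succ]
  have hj : (j.factorial : ℝ) ≠ 0 := by positivity
  have hj1 : (j : ℝ) + 1 ≠ 0 := by positivity
  push_cast
  field_simp
  ring

theorem nc_vanish (σ : ℝ) (n k m : ℕ) : ∀ j, m < j → ncGenFactCoeff σ n k m j = 0 := by
  induction m with
  | zero =>
    intro j hj
    obtain ⟨i, rfl⟩ := Nat.exists_eq_succ_of_ne_zero (by omega : j ≠ 0)
    exact nc_zero_succ σ n k i
  | succ m ih =>
    intro j hj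
    obtain ⟨i, rfl⟩ := Nat.exists_eq_succ_of_ne_zero (by omega : j ≠ 0)
    rw [Nat.succ_eq_add_one, nc_succ_succ, ih (i + 1) (by omega), ih i (by omega)]
    ring

theorem nc_sum_succ (σ : ℝ) (n k m : ℕ) (g : ℕ → ℝ) :
    ∑ j ∈ Finset.range (m + 1 + 1), g j * ncGenFactCoeff σ n k (m + 1) j =
      ∑ j ∈ Finset.range (m + 1),
        (g j * ((n : ℝ) - σ * k + m - σ * j) + σ * g (j + 1)) * ncGenFactCoeff σ n k m j := by
  have h1 : ∑ j ∈ Finset.range (m + 1),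
      g j * ((n : ℝ) - σ * k + m - σ * j) * ncGenFactCoeff σ n k m j =
      ∑ j ∈ Finset.range (m + 1 + 1),
      g j * ((n : ℝ) - σ * k + m - σ * j) * ncGenFactCoeff σ n k m j := by
    rw [Finset.sum_range_succ _ (m + 1), nc_vanish σ n k m (m + 1) (by omega)]
    ring
  simp only [add_mul]
  rw [Finset.sum_add_distrib, h1, Finset.sum_range_succ', Finset.sum_range_succ' _ (m + 1),
    nc_succ_zero, add_right_comm, ← Finset.sum_add_distrib]
  congr 1
  · refine Finset.sum_congr rfl fun j _ => ?_
    rw [nc_succ_succ]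
    push_cast
    ring
  · push_cast
    ring

theorem nc_S (σ x b : ℝ) (n k m : ℕ) (hb : (n : ℝ) - σ * k + σ * x = b) :
    ∑ j ∈ Finset.range (m + 1), risingFactorial x j * ncGenFactCoeff σ n k m j =
      risingFactorial b m := by
  induction m with
  | zero => simp [nc_zero_zero, risingFactorial]
  | succ m ih =>
    rw [nc_sum_succ, risingFactorial, ← ih, Finset.sum_mul]
    refine Finset.sum_congr rfl fun j _ => ?_
    rw [risingFactorial, ← hb]
    ring

theorem nc_T (σ x b : ℝ) (n k m : ℕ) (hb : (n : ℝ) - σ * k + σ * x = b) :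
    ∑ j ∈ Finset.range (m + 1), (j * risingFactorial x j) * ncGenFactCoeff σ n k m j =
      x * (risingFactorial (b + σ) m - risingFactorial b m) := by
  induction m with
  | zero => simp [risingFactorial]
  | succ m ih =>
    have h : ∑ j ∈ Finset.range (m + 1 + 1),
          (j * risingFactorial x j) * ncGenFactCoeff σ n k (m + 1) j =
        (b + σ + m) * ∑ j ∈ Finset.range (m + 1),
            (j * risingFactorial x j) * ncGenFactCoeff σ n k m j
          + σ * x * ∑ j ∈ Finset.range (m + 1),
            risingFactorial x j * ncGenFactCoeff σ n k m j := by
      rw [nc_sum_succ σ n k m (fun j => j * risingFactorial x j), Finset.mul_sum,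
        Finset.mul_sum, ← Finset.sum_add_distrib]
      refine Finset.sum_congr rfl fun j _ => ?_
      simp only [risingFactorial]
      rw [← hb]
      push_cast
      ring
    rw [h, ih, nc_S σ x b n k m hb]
    simp only [risingFactorial]
    ring

theorem rf_pos (x : ℝ) (hx : 0 < x) (m : ℕ) : 0 < risingFactorial x m := by
  induction m with
  | zero => simp [risingFactorial]
  | succ m ih =>
    rw [risingFactorial]
    positivity

/-- For `σ ∈ (0,1)`, `θ > -σ`, and integers `1 ≤ k ≤ n`, `m ≥ 1`, the expected number
of new species under the Pitman–Yor process satisfies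
`∑_{j=0}^m j (θ/σ+k)_j 𝒞(m,j;σ,-n+kσ)/(θ+n)_m = (k + θ/σ)((θ+n+σ)_m/(θ+n)_m − 1)`. -/
theorem py_expected_new_species (σ θ : ℝ) (hσ0 : 0 < σ) (hσ1 : σ < 1)
    (hθ : θ > -σ) (n k m : ℕ) (hk : 1 ≤ k) (hkn : k ≤ n) (hm : 1 ≤ m) :
    ∑ j ∈ Finset.range (m + 1),
        (j : ℝ) * risingFactorial (θ / σ + k) j * ncGenFactCoeff σ n k m j /
          risingFactorial (θ + n) m =
      ((k : ℝ) + θ / σ) *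
        (risingFactorial (θ + n + σ) m / risingFactorial (θ + n) m - 1) := by
  have hn : (1 : ℝ) ≤ n := by exact_mod_cast hk.trans hkn
  have hpos := rf_pos (θ + n) (by linarith) m
  have hb : (n : ℝ) - σ * k + σ * (θ / σ + k) = θ + n := by
    field_simp
    ring
  rw [← Finset.sum_div, nc_T σ (θ / σ + k) (θ + n) n k m hb]
  rw [div_sub_one hpos.ne', add_comm (k : ℝ), mul_div_assoc]
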